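/- arXiv:1212.2918 — 3 statements merged into one kernel-verified Lean document; each statement's English description precedes it below -/
import Mathlib

section
/- On ℝ^{n+1} × ℝ^{n+1} with coordinates (q_0,…,q_n, p_0,…,p_n), define for each k = 0,…,n the polynomial function H_k(q,p) = (1/2)·Σ_{i=0}^k (q_i² + p_i²)² + Σ_{0 ≤ i < j ≤ k} [ (q_i q_j + p_i p_j)² + (q_j p_i − p_j q_i)² ]. Then the functions H_0, …, H_n pairwise Poisson-commute, {H_k, H_l} = 0 for all 0 ≤ k, l ≤ n, and each H_k Poisson-commutes with the harmonic-oscillator Hamiltonian Σ_{i=0}^n (q_i² + p_i²)/2. -/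
open Finset

/-- The canonical Poisson bracket on `ℝ^N(q) × ℝ^N(p)`:
`{A,B} = Σ_j (∂A/∂q_j · ∂B/∂p_j − ∂A/∂p_j · ∂B/∂q_j)`, where partial
derivatives are real directional (Fréchet) derivatives along basis vectors. -/
noncomputable def poissonBracket {N : ℕ}
    (A B : ((Fin N → ℝ) × (Fin N → ℝ)) → ℝ)
    (x : (Fin N → ℝ) × (Fin N → ℝ)) : ℝ :=
  ∑ j, (fderiv ℝ A x (Pi.single j 1, 0) * fderiv ℝ B x (0, Pi.single j 1)
      - fderiv ℝ A x (0, Pi.single j 1) * fderiv ℝ B x (Pi.single j 1, 0))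

/-- The Gelfand–Cetlin collective Hamiltonians
`H_k(q,p) = (1/2)·Σ_{i ≤ k} (q_i² + p_i²)² +
  Σ_{i < j ≤ k} [(q_i q_j + p_i p_j)² + (q_j p_i − p_j q_i)²]`. -/
noncomputable def GCham (n : ℕ) (k : Fin (n+1))
    (x : (Fin (n+1) → ℝ) × (Fin (n+1) → ℝ)) : ℝ :=
  (1/2) * ∑ i ∈ Finset.univ.filter (fun i => i ≤ k), ((x.1 i)^2 + (x.2 i)^2)^2
  + ∑ j ∈ Finset.univ.filter (fun j => j ≤ k),
      ∑ i ∈ Finset.univ.filter (fun i => i < j),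
        ((x.1 i * x.1 j + x.2 i * x.2 j)^2 + (x.1 j * x.2 i - x.2 j * x.1 i)^2)

/-- At `x`, the function `A` is differentiable and its partial derivatives in `(q_j, p_j)` are
proportional to `(q_j, p_j)`, as is the case for functions of the actions `q_j² + p_j²`. -/
def HasRadialDerivAt {N : ℕ} (A : ((Fin N → ℝ) × (Fin N → ℝ)) → ℝ)
    (x : (Fin N → ℝ) × (Fin N → ℝ)) : Prop :=
  DifferentiableAt ℝ A x ∧ ∃ c : Fin N → ℝ, ∀ j,
    fderiv ℝ A x (Pi.single j 1, 0) = c j * x.1 j ∧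
    fderiv ℝ A x (0, Pi.single j 1) = c j * x.2 j

namespace HasRadialDerivAt

variable {N : ℕ} {A B : ((Fin N → ℝ) × (Fin N → ℝ)) → ℝ} {x : (Fin N → ℝ) × (Fin N → ℝ)}

theorem poissonBracket_eq_zero (hA : HasRadialDerivAt A x) (hB : HasRadialDerivAt B x) :
    poissonBracket A B x = 0 := by
  obtain ⟨-, a, ha⟩ := hA
  obtain ⟨-, b, hb⟩ := hB
  refine Finset.sum_eq_zero fun j _ => ?_
  rw [(ha j).1, (ha j).2, (hb j).1, (hb j).2]
  ring

theorem const (r : ℝ) : HasRadialDerivAt (fun _ => r) x :=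
  ⟨differentiableAt_const r, 0, fun j => by simp⟩

theorem add (hA : HasRadialDerivAt A x) (hB : HasRadialDerivAt B x) :
    HasRadialDerivAt (fun y => A y + B y) x := by
  obtain ⟨dA, a, ha⟩ := hA
  obtain ⟨dB, b, hb⟩ := hB
  refine ⟨dA.add dB, fun j => a j + b j, fun j => ?_⟩
  rw [fderiv_fun_add dA dB]
  simp only [add_apply, (ha j).1, (ha j).2, (hb j).1, (hb j).2]
  constructor <;> ring

theorem mul (hA : HasRadialDerivAt A x) (hB : HasRadialDerivAt B x) :
    HasRadialDerivAt (fun y => A y * B y) x := by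
  obtain ⟨dA, a, ha⟩ := hA
  obtain ⟨dB, b, hb⟩ := hB
  refine ⟨dA.mul dB, fun j => A x * b j + B x * a j, fun j => ?_⟩
  rw [fderiv_fun_mul dA dB]
  simp only [add_apply, smul_apply, smul_eq_mul,
    (ha j).1, (ha j).2, (hb j).1, (hb j).2]
  constructor <;> ring

theorem sum {ι : Type*} (s : Finset ι) {F : ι → ((Fin N → ℝ) × (Fin N → ℝ)) → ℝ}
    (hF : ∀ i ∈ s, HasRadialDerivAt (F i) x) :
    HasRadialDerivAt (fun y => ∑ i ∈ s, F i y) x := by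
  classical
  induction s using Finset.induction_on with
  | empty => simpa using const (x := x) 0
  | insert i s his ih =>
    simp only [Finset.sum_insert his]
    exact (hF i (Finset.mem_insert_self i s)).add
      (ih fun j hj => hF j (Finset.mem_insert_of_mem hj))

theorem action (i : Fin N) : HasRadialDerivAt (fun y => (y.1 i) ^ 2 + (y.2 i) ^ 2) x := by
  have hq := hasFDerivAt_pi'.1 (hasFDerivAt_fst (𝕜 := ℝ) (p := x)) i
  have hp := hasFDerivAt_pi'.1 (hasFDerivAt_snd (𝕜 := ℝ) (p := x)) i
  have h := (hq.pow 2).add (hp.pow 2)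
  refine ⟨h.differentiableAt, Pi.single i 2, fun j => ?_⟩
  erw [h.fderiv]
  rcases eq_or_ne i j with rfl | hij
  · simp
  · simp [hij, hij.symm]

end HasRadialDerivAt

theorem hasRadialDerivAt_GCham (n : ℕ) (k : Fin (n+1))
    (x : (Fin (n+1) → ℝ) × (Fin (n+1) → ℝ)) : HasRadialDerivAt (GCham n k) x := by
  refine ((HasRadialDerivAt.const _).mul (.sum _ fun i _ => ?_)).add
    (.sum _ fun j _ => .sum _ fun i _ => ?_)
  · simpa only [sq (_ + _)] using (HasRadialDerivAt.action i).mul (.action i)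
  · convert (HasRadialDerivAt.action (x := x) i).mul (.action j) using 2
    ring

theorem hasRadialDerivAt_harmonicOscillator {N : ℕ} (x : (Fin N → ℝ) × (Fin N → ℝ)) :
    HasRadialDerivAt (fun y => ∑ i, ((y.1 i)^2 + (y.2 i)^2) / 2) x := by
  simp only [div_eq_mul_inv]
  exact .sum _ fun i _ => (HasRadialDerivAt.action i).mul (.const _)

/-- The functions `H_0, …, H_n` pairwise Poisson-commute and
each of them Poisson-commutes with the harmonic-oscillator Hamiltonian
`Σ_i (q_i² + p_i²)/2`. -/
theorem gelfand_cetlin_poisson_commute (n : ℕ) :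
    (∀ (k l : Fin (n+1)) (x : (Fin (n+1) → ℝ) × (Fin (n+1) → ℝ)),
      poissonBracket (GCham n k) (GCham n l) x = 0) ∧
    (∀ (k : Fin (n+1)) (x : (Fin (n+1) → ℝ) × (Fin (n+1) → ℝ)),
      poissonBracket (GCham n k) (fun y => ∑ i, ((y.1 i)^2 + (y.2 i)^2) / 2) x = 0) := by
  exact ⟨fun k l x =>
      (hasRadialDerivAt_GCham n k x).poissonBracket_eq_zero (hasRadialDerivAt_GCham n l x),
    fun k x => (hasRadialDerivAt_GCham n k x).poissonBracket_eq_zero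
      (hasRadialDerivAt_harmonicOscillator x)⟩
end

section
/- Let a_0,…,a_n be positive integers, G(z) = Σ_{j=0}^n z_j^{a_j}, G_1 = Re G, G_2 = Im G, and define V_1(z) = (2i·conj(z_0)^{a_0−1}, …, 2i·conj(z_n)^{a_n−1}) and V_2(z) = (−2·conj(z_0)^{a_0−1}, …, −2·conj(z_n)^{a_n−1}). Then for all z, v ∈ ℂ^{n+1}: ω_a(V_1(z), v) = −(dG_1)_z(v) and ω_a(V_2(z), v) = −(dG_2)_z(v), where ω_a(u,v) = (1/2)·Σ_{j=0}^n a_j·Im(conj(u_j)·v_j). Thus V_1 and V_2 are, up to their components along the Reeb direction, the contact Hamiltonian vector fields of G_1 and G_2 on (S^{2n+1}, α). -/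
open Finset ComplexConjugate

/-- The 2-form `ω_a(u,v) = (1/2)·Σ_j a_j·Im(conj(u_j)·v_j)`. -/
noncomputable def sphOmega {N : ℕ} (a : Fin N → ℝ) (u v : Fin N → ℂ) : ℝ :=
  (1/2) * ∑ j, a j * (conj (u j) * v j).im

/-- The Brieskorn polynomial `G(z) = Σ_j z_j^{a_j}`. -/
noncomputable def brG {N : ℕ} (a : Fin N → ℕ) (z : Fin N → ℂ) : ℂ :=
  ∑ j, z j ^ a j

/-- `V₁(z)_j = 2i·conj(z_j)^{a_j−1}`. -/
noncomputable def brV1 {N : ℕ} (a : Fin N → ℕ) (z : Fin N → ℂ) : Fin N → ℂ :=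
  fun j => 2 * Complex.I * (conj (z j)) ^ (a j - 1)

/-- `V₂(z)_j = −2·conj(z_j)^{a_j−1}`. -/
noncomputable def brV2 {N : ℕ} (a : Fin N → ℕ) (z : Fin N → ℂ) : Fin N → ℂ :=
  fun j => -2 * (conj (z j)) ^ (a j - 1)

/-- The real derivative of `G` at `z` sends `v` to `Σ_j a_j·z_j^{a_j−1}·v_j`. -/
theorem hasFDerivAt_brG {N : ℕ} (a : Fin N → ℕ) (z : Fin N → ℂ) :
    HasFDerivAt (brG a)
      (∑ j, ((a j : ℂ) * z j ^ (a j - 1)) •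
        (ContinuousLinearMap.proj j : (Fin N → ℂ) →L[ℝ] ℂ)) z := by
  have h : HasFDerivAt (fun w : Fin N → ℂ => ∑ j, w j ^ a j) _ z :=
    HasFDerivAt.fun_sum fun j _ => (hasFDerivAt_apply (𝕜 := ℝ) j z).pow (a j)
  refine h.congr_fderiv ?_
  ext v
  simp

theorem fderiv_re_brG {N : ℕ} (a : Fin N → ℕ) (z v : Fin N → ℂ) :
    fderiv ℝ (fun w => (brG a w).re) z v = ∑ j, ((a j : ℂ) * z j ^ (a j - 1) * v j).re := by
  have h := Complex.reCLM.hasFDerivAt.comp z (hasFDerivAt_brG a z)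
  have h' : fderiv ℝ (fun w => (brG a w).re) z = _ := h.fderiv
  rw [h']
  simp [-Complex.mul_re]

theorem fderiv_im_brG {N : ℕ} (a : Fin N → ℕ) (z v : Fin N → ℂ) :
    fderiv ℝ (fun w => (brG a w).im) z v = ∑ j, ((a j : ℂ) * z j ^ (a j - 1) * v j).im := by
  have h := Complex.imCLM.hasFDerivAt.comp z (hasFDerivAt_brG a z)
  have h' : fderiv ℝ (fun w => (brG a w).im) z = _ := h.fderiv
  rw [h']
  simp [-Complex.mul_im]

/-- `ω_a(V₁(z), v) = −(dG₁)_z(v)` and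
`ω_a(V₂(z), v) = −(dG₂)_z(v)`, where `G₁ = Re G`, `G₂ = Im G`. Thus, up to
their components along the Reeb direction, `V₁` and `V₂` are the contact
Hamiltonian vector fields of `G₁` and `G₂` on `(S^{2n+1}, α)`. -/
theorem brieskorn_V_fields_are_hamiltonian
    (n : ℕ) (a : Fin (n+1) → ℕ) (ha : ∀ j, 0 < a j) :
    ∀ (z v : Fin (n+1) → ℂ),
      sphOmega (fun j => (a j : ℝ)) (brV1 a z) v
        = -(fderiv ℝ (fun w => (brG a w).re) z v) ∧
      sphOmega (fun j => (a j : ℝ)) (brV2 a z) v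
        = -(fderiv ℝ (fun w => (brG a w).im) z v) := by
  intro z v
  rw [fderiv_re_brG, fderiv_im_brG]
  simp only [sphOmega, brV1, brV2, Finset.mul_sum, ← Finset.sum_neg_distrib]
  constructor <;> refine Finset.sum_congr rfl fun j _ => ?_
  · simp only [map_mul, map_pow, Complex.conj_conj, Complex.conj_I, map_ofNat, mul_assoc]
    generalize z j ^ (a j - 1) * v j = w
    simp
    ring
  · simp only [map_mul, map_pow, Complex.conj_conj, map_neg, map_ofNat, mul_assoc]
    generalize z j ^ (a j - 1) * v j = w
    simp
    ring
end

section
/- Let n = 2m+1 and identify ℂ^{n+1} with ℝ^{n+1}(q) × ℝ^{n+1}(p) via z_j = p_j + i·q_j. Consider the functions f_0 = q_0² + p_0², f_1 = q_1² + p_1², h_i = (q_{2i}² + p_{2i}²) + (q_{2i+1}² + p_{2i+1}²) for i = 1,…,m, g_i = 2·(q_{2i}·p_{2i+1} − q_{2i+1}·p_{2i}) for i = 1,…,m (equivalently g_i(z) = 2·Im(z_{2i}·conj(z_{2i+1}))), and F = Σ_{j=0}^n (q_j² + p_j²). Then all of these 2m+3 functions pairwise Poisson-commute with respect to the canonical Poisson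 bracket {A,B}(q,p) = Σ_{j=0}^n ( ∂A/∂q_j · ∂B/∂p_j − ∂A/∂p_j · ∂B/∂q_j ). -/
open Finset

/-- The quadratic Hamiltonian `Σ_j (c_j (q_j² + p_j²) + 2 s_j q_j p_{σ j})`. -/
def pairedQuadratic {N : ℕ} (σ : Fin N → Fin N) (c s : Fin N → ℝ)
    (x : (Fin N → ℝ) × (Fin N → ℝ)) : ℝ :=
  ∑ j, (c j * (x.1 j ^ 2 + x.2 j ^ 2) + 2 * s j * (x.1 j * x.2 (σ j)))

lemma fderiv_pairedQuadratic {N : ℕ} (σ : Fin N → Fin N) (c s : Fin N → ℝ)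
    (x v : (Fin N → ℝ) × (Fin N → ℝ)) :
    fderiv ℝ (pairedQuadratic σ c s) x v =
      ∑ j, (c j * (2 * x.1 j * v.1 j + 2 * x.2 j * v.2 j)
        + 2 * s j * (x.1 j * v.2 (σ j) + v.1 j * x.2 (σ j))) := by
  have hq (j : Fin N) : HasFDerivAt (fun y : (Fin N → ℝ) × (Fin N → ℝ) => y.1 j)
      ((ContinuousLinearMap.proj (R := ℝ) (φ := fun _ : Fin N => ℝ) j).comp
        (ContinuousLinearMap.fst ℝ (Fin N → ℝ) (Fin N → ℝ))) x :=
    ((ContinuousLinearMap.proj (R := ℝ) (φ := fun _ : Fin N => ℝ) j).comp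
      (ContinuousLinearMap.fst ℝ (Fin N → ℝ) (Fin N → ℝ))).hasFDerivAt
  have hp (j : Fin N) : HasFDerivAt (fun y : (Fin N → ℝ) × (Fin N → ℝ) => y.2 j)
      ((ContinuousLinearMap.proj (R := ℝ) (φ := fun _ : Fin N => ℝ) j).comp
        (ContinuousLinearMap.snd ℝ (Fin N → ℝ) (Fin N → ℝ))) x :=
    ((ContinuousLinearMap.proj (R := ℝ) (φ := fun _ : Fin N => ℝ) j).comp
      (ContinuousLinearMap.snd ℝ (Fin N → ℝ) (Fin N → ℝ))).hasFDerivAt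
  have h : HasFDerivAt (pairedQuadratic σ c s) _ x :=
    HasFDerivAt.fun_sum fun j (_ : j ∈ univ) =>
      ((((hq j).pow 2).add ((hp j).pow 2)).const_mul (c j)).add
        (((hq j).mul (hp (σ j))).const_mul (2 * s j))
  rw [h.fderiv]
  simp only [_root_.sum_apply]
  refine sum_congr rfl fun j _ => ?_
  simp
  ring

lemma fderiv_pairedQuadratic_position {N : ℕ} (σ : Fin N → Fin N) (c s : Fin N → ℝ)
    (x : (Fin N → ℝ) × (Fin N → ℝ)) (j : Fin N) :
    fderiv ℝ (pairedQuadratic σ c s) x (Pi.single j 1, 0) =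
      2 * (c j * x.1 j + s j * x.2 (σ j)) := by
  rw [fderiv_pairedQuadratic, sum_eq_single j]
  · simp
    ring
  · intro k _ hk
    simp [hk]
  · simp

lemma fderiv_pairedQuadratic_momentum {N : ℕ} {σ : Fin N → Fin N} (hσ : σ.Involutive)
    (c s : Fin N → ℝ) (x : (Fin N → ℝ) × (Fin N → ℝ)) (j : Fin N) :
    fderiv ℝ (pairedQuadratic σ c s) x (0, Pi.single j 1) =
      2 * (c j * x.2 j + s (σ j) * x.1 (σ j)) := by
  rw [fderiv_pairedQuadratic, sum_add_distrib, sum_eq_single j, sum_eq_single (σ j)]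
  · simp [hσ j]
    ring
  · intro k _ hk
    have : σ k ≠ j := fun h => hk (by rw [← h, hσ k])
    simp [this]
  · simp
  · intro k _ hk
    simp [hk]
  · simp

/-- Paired quadratic Hamiltonians with `σ`-invariant `c` and `σ`-anti-invariant `s`
Poisson-commute. -/
lemma poissonBracket_pairedQuadratic {N : ℕ} {σ : Fin N → Fin N} (hσ : σ.Involutive)
    {c s c' s' : Fin N → ℝ} (hc : ∀ j, c (σ j) = c j) (hs : ∀ j, s (σ j) = -s j)
    (hc' : ∀ j, c' (σ j) = c' j) (hs' : ∀ j, s' (σ j) = -s' j)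
    (x : (Fin N → ℝ) × (Fin N → ℝ)) :
    poissonBracket (pairedQuadratic σ c s) (pairedQuadratic σ c' s') x = 0 := by
  set t : Fin N → ℝ := fun j =>
    4 * ((s j * c' j - c j * s' j) * (x.1 j * x.1 (σ j) + x.2 j * x.2 (σ j))) with ht
  have hbracket :
      poissonBracket (pairedQuadratic σ c s) (pairedQuadratic σ c' s') x = ∑ j, t j := by
    refine sum_congr rfl fun j _ => ?_
    rw [fderiv_pairedQuadratic_position, fderiv_pairedQuadratic_position,
      fderiv_pairedQuadratic_momentum hσ, fderiv_pairedQuadratic_momentum hσ, hs, hs', ht]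
    ring
  have hodd (j : Fin N) : t (σ j) = -t j := by
    simp only [ht, hσ j, hc, hs, hc', hs']
    ring
  have hsum : ∑ j, t (σ j) = ∑ j, t j := Equiv.sum_comp hσ.toPerm t
  simp only [hodd, sum_neg_distrib] at hsum
  linarith

/-- The involution of `Fin (2m+2)` fixing `0` and `1` and exchanging `2i` with `2i+1`
for `i ≥ 1`. -/
def pairSwap (m : ℕ) (j : Fin (2 * m + 2)) : Fin (2 * m + 2) :=
  ⟨if j.val < 2 then j.val else if j.val % 2 = 0 then j.val + 1 else j.val - 1, by
    have := j.isLt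
    split_ifs <;> omega⟩

lemma pairSwap_involutive (m : ℕ) : (pairSwap m).Involutive := by
  intro j
  apply Fin.ext
  simp only [pairSwap]
  split_ifs <;> omega

/-- With `n = 2m+1` and `z_j = p_j + i·q_j`, the `2m+3`
functions `f₀ = q₀² + p₀²`, `f₁ = q₁² + p₁²`,
`h_i = (q_{2i}² + p_{2i}²) + (q_{2i+1}² + p_{2i+1}²)`,
`g_i = 2(q_{2i}p_{2i+1} − q_{2i+1}p_{2i})` (`i = 1,…,m`) and
`F = Σ_j (q_j² + p_j²)` pairwise Poisson-commute with respect to the canonical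
Poisson bracket. -/
theorem ustilovsky_integrals_poisson_commute
    (m : ℕ)
    (fam : (Fin 3 ⊕ Fin m ⊕ Fin m) → ((Fin (2*m+2) → ℝ) × (Fin (2*m+2) → ℝ)) → ℝ)
    (hf0 : fam (Sum.inl 0) = fun x =>
      (x.1 ⟨0, by omega⟩)^2 + (x.2 ⟨0, by omega⟩)^2)
    (hf1 : fam (Sum.inl 1) = fun x =>
      (x.1 ⟨1, by omega⟩)^2 + (x.2 ⟨1, by omega⟩)^2)
    (hF : fam (Sum.inl 2) = fun x => ∑ j, ((x.1 j)^2 + (x.2 j)^2))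
    (hh : ∀ i : Fin m, fam (Sum.inr (Sum.inl i)) = fun x =>
      ((x.1 ⟨2*(i.val+1), by have := i.isLt; omega⟩)^2
        + (x.2 ⟨2*(i.val+1), by have := i.isLt; omega⟩)^2)
      + ((x.1 ⟨2*(i.val+1)+1, by have := i.isLt; omega⟩)^2
        + (x.2 ⟨2*(i.val+1)+1, by have := i.isLt; omega⟩)^2))
    (hg : ∀ i : Fin m, fam (Sum.inr (Sum.inr i)) = fun x =>
      2 * (x.1 ⟨2*(i.val+1), by have := i.isLt; omega⟩
            * x.2 ⟨2*(i.val+1)+1, by have := i.isLt; omega⟩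
          - x.1 ⟨2*(i.val+1)+1, by have := i.isLt; omega⟩
            * x.2 ⟨2*(i.val+1), by have := i.isLt; omega⟩)) :
    ∀ (A B : Fin 3 ⊕ Fin m ⊕ Fin m) (x : (Fin (2*m+2) → ℝ) × (Fin (2*m+2) → ℝ)),
      poissonBracket (fam A) (fam B) x = 0 := by
  suffices h : ∀ A, ∃ c s : Fin (2 * m + 2) → ℝ,
      (∀ j, c (pairSwap m j) = c j) ∧ (∀ j, s (pairSwap m j) = -s j) ∧
        fam A = pairedQuadratic (pairSwap m) c s by
    intro A B x
    obtain ⟨c, s, hc, hs, hA⟩ := h A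
    obtain ⟨c', s', hc', hs', hB⟩ := h B
    rw [hA, hB]
    exact poissonBracket_pairedQuadratic (pairSwap_involutive m) hc hs hc' hs' x
  rintro (k | i | i)
  · fin_cases k
    · refine ⟨Pi.single ⟨0, by omega⟩ 1, 0, fun j => ?_, by simp, hf0.trans ?_⟩
      · simp only [Pi.single_apply, Fin.ext_iff, pairSwap]
        split_ifs <;> first | contradiction | omega | norm_num
      · funext x
        simp [pairedQuadratic, Pi.single_apply]
    · refine ⟨Pi.single ⟨1, by omega⟩ 1, 0, fun j => ?_, by simp, hf1.trans ?_⟩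
      · simp only [Pi.single_apply, Fin.ext_iff, pairSwap]
        split_ifs <;> first | omega | norm_num
      · funext x
        simp [pairedQuadratic, Pi.single_apply]
    · refine ⟨1, 0, by simp, by simp, hF.trans ?_⟩
      funext x
      simp [pairedQuadratic]
  · have := i.isLt
    refine ⟨Pi.single ⟨2 * (i.val + 1), by omega⟩ 1 + Pi.single ⟨2 * (i.val + 1) + 1, by omega⟩ 1,
      0, fun j => ?_, by simp, (hh i).trans ?_⟩
    · simp only [Pi.add_apply, Pi.single_apply, Fin.ext_iff, pairSwap]
      split_ifs <;> first | omega | norm_num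
    · funext x
      simp [pairedQuadratic, Pi.single_apply, add_mul, sum_add_distrib]
  · have := i.isLt
    refine ⟨0,
      Pi.single ⟨2 * (i.val + 1), by omega⟩ 1 - Pi.single ⟨2 * (i.val + 1) + 1, by omega⟩ 1,
      by simp, fun j => ?_, (hg i).trans ?_⟩
    · simp only [Pi.sub_apply, Pi.single_apply, Fin.ext_iff, pairSwap]
      split_ifs <;> first | omega | norm_num
    · have heven : pairSwap m ⟨2 * (i.val + 1), by omega⟩ = ⟨2 * (i.val + 1) + 1, by omega⟩ := by
        apply Fin.ext
        simp only [pairSwap]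
        split_ifs <;> omega
      have hodd : pairSwap m ⟨2 * (i.val + 1) + 1, by omega⟩ = ⟨2 * (i.val + 1), by omega⟩ := by
        rw [← heven, pairSwap_involutive]
      funext x
      simp [pairedQuadratic, Pi.single_apply, mul_sub, sub_mul, sum_sub_distrib, heven, hodd]
end
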